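/- Let s ∈ {1,…,p}, γ ∈ (0,1) and τ ∈ [0,1−γ), and set c₀ = (1+γ+τ)/(1−γ−τ). Let the Slope weights be λ_j = Aσ√(log(2p/j)/n), j = 1,…,p, with A ≥ (4+√2)/γ, and let δ₀ ∈ (0,1). Then, on the event { (1/n)ξᵀXu ≤ max(H(u), G(u)) ∀u ∈ ℝᵖ }, the Slope estimator β̂ satisfies 2τ‖β̂ − β‖_* + ‖Xβ̂ − f‖ₙ² ≤ ‖Xβ − f‖ₙ² + C′_{γ,τ}(s,δ₀)·∑_{j=1}^s λ_j² simultaneously for all f ∈ ℝⁿ, all s = 1,…,p, and all β ∈ ℝᵖ with ‖β‖₀ = s, where C′_{γ,τ}(s,δ₀) = (1+γ+τ)²·max( log(1/δ₀)/(s·log(2p/s)), 1/ϑ²(s,c₀(γ,τ)) ) if the WRE(s,c₀) condition holds, and C′_{γ,τ}(s,δ₀) = ∞ otherwise. Furthermore, if f = Xβ* for some β* ∈ ℝᵖ with ‖β*‖₀ ≤ s, then on the same event 2τ‖β̂ − β*‖_* ≤ C′_{γ,τ}(s,δ₀)·∑_{j=1}^s λ_j² and ‖β̂ − β*‖₂ ≤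 (C′_{γ,0}(s,δ₀)/(1+γ))·(∑_{j=1}^s λ_j²)^{1/2}. -/

import Mathlib

open MeasureTheory ProbabilityTheory Real Finset
open scoped ENNReal NNReal BigOperators Classical

noncomputable section

/-- Empirical norm `‖u‖ₙ = √((1/n) ∑ᵢ uᵢ²)`. -/
def normn (n : ℕ) (u : Fin n → ℝ) : ℝ := Real.sqrt ((∑ i, (u i) ^ 2) / n)

/-- Euclidean (`ℓ₂`) norm on `ℝᵖ`. -/
def l2 (p : ℕ) (u : Fin p → ℝ) : ℝ := Real.sqrt (∑ j, (u j) ^ 2)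

/-- `ℓ₁` norm on `ℝᵖ`. -/
def l1 (p : ℕ) (u : Fin p → ℝ) : ℝ := ∑ j, |u j|

/-- Number of nonzero coordinates `‖u‖₀`. -/
def sparsity (p : ℕ) (u : Fin p → ℝ) : ℕ := (Finset.univ.filter fun j => u j ≠ 0).card

/-- Non-increasing rearrangement of `(|u₁|,…,|u_p|)`:
`sharp p u j` is the `(j+1)`-st largest value among the `|u i|` (0-indexed `j`). -/
def sharp (p : ℕ) (u : Fin p → ℝ) : Fin p → ℝ :=
  fun j => |u ((Tuple.sort fun i => -|u i|) j)|

/-- The function `H(u) = (4+√2) ∑ⱼ u♯ⱼ σ √(log(2p/j)/n)`. -/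
def Hfun (n p : ℕ) (σ : ℝ) (u : Fin p → ℝ) : ℝ :=
  (4 + Real.sqrt 2) *
    ∑ j : Fin p, sharp p u j * σ * Real.sqrt (Real.log (2 * p / ((j : ℕ) + 1)) / n)

/-- The function `G(u) = (4+√2) σ √(log(1/δ₀)/n) ‖Xu‖ₙ`. -/
def Gfun (n p : ℕ) (σ δ₀ : ℝ) (X : Matrix (Fin n) (Fin p) ℝ) (u : Fin p → ℝ) : ℝ :=
  (4 + Real.sqrt 2) * σ * Real.sqrt (Real.log (1 / δ₀) / n) * normn n (X.mulVec u)

/-- The event `{ (1/n) ξᵀXu ≤ max(H(u), G(u)) for all u ∈ ℝᵖ }`. -/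
def MainEvent (n p : ℕ) (σ δ₀ : ℝ) (X : Matrix (Fin n) (Fin p) ℝ) (xi : Fin n → ℝ) : Prop :=
  ∀ u : Fin p → ℝ,
    (1 / n : ℝ) * ∑ i, xi i * X.mulVec u i ≤ max (Hfun n p σ u) (Gfun n p σ δ₀ X u)

/-- The Slope weights `λⱼ = Aσ√(log(2p/j)/n)`, indexed by `j ∈ {1,…,p}`. -/
def slopeWeight (n p : ℕ) (A σ : ℝ) (j : ℕ) : ℝ :=
  A * σ * Real.sqrt (Real.log (2 * p / j) / n)

/-- The sorted `ℓ₁` norm `‖u‖₊ = ∑ⱼ λⱼ u♯ⱼ` associated with weights `lam` (1-indexed). -/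
def sortedL1 (p : ℕ) (lam : ℕ → ℝ) (u : Fin p → ℝ) : ℝ :=
  ∑ j : Fin p, lam ((j : ℕ) + 1) * sharp p u j

/-- `b` is a Slope solution with design `X`, weights `lam` and data `y`. -/
def IsSlopeSol (n p : ℕ) (X : Matrix (Fin n) (Fin p) ℝ) (lam : ℕ → ℝ)
    (y : Fin n → ℝ) (b : Fin p → ℝ) : Prop :=
  ∀ β : Fin p → ℝ,
    normn n (X.mulVec b - y) ^ 2 + 2 * sortedL1 p lam b ≤
      normn n (X.mulVec β - y) ^ 2 + 2 * sortedL1 p lam β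

/-- The WRE constant `ϑ(s,c₀)`: infimum of `‖Xδ‖ₙ/‖δ‖₂` over the cone
`{δ ≠ 0 : ‖δ‖₊ ≤ (1+c₀)‖δ‖₂ (∑_{j=1}^s λⱼ²)^{1/2}}`. -/
def thetaWRE (n p : ℕ) (X : Matrix (Fin n) (Fin p) ℝ) (lam : ℕ → ℝ) (s : ℕ) (c0 : ℝ) : ℝ :=
  sInf ((fun δ => normn n (X.mulVec δ) / l2 p δ) ''
    {δ : Fin p → ℝ | δ ≠ 0 ∧
      sortedL1 p lam δ ≤ (1 + c0) * l2 p δ * Real.sqrt (∑ j ∈ Finset.Icc 1 s, lam j ^ 2)})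

/-- The constant `C'_{γ,τ}(s,δ₀) = (1+γ+τ)² max( log(1/δ₀)/(s log(2p/s)),
1/ϑ²(s,c₀(γ,τ)) )` with `c₀(γ,τ) = (1+γ+τ)/(1-γ-τ)`. -/
def Cslope (n p : ℕ) (X : Matrix (Fin n) (Fin p) ℝ) (lam : ℕ → ℝ) (γ τ : ℝ) (s : ℕ)
    (δ₀ : ℝ) : ℝ :=
  (1 + γ + τ) ^ 2 *
    max (Real.log (1 / δ₀) / (s * Real.log (2 * p / s)))
        (1 / thetaWRE n p X lam s ((1 + γ + τ) / (1 - γ - τ)) ^ 2)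


/-! ### Sorted norms -/

lemma sharp_antitone (p : ℕ) (u : Fin p → ℝ) : Antitone (sharp p u) := by
  intro i j hij
  have := Tuple.monotone_sort (fun i => -|u i|) hij
  simp only [Function.comp] at this
  simp only [sharp]
  linarith

lemma rearr {p : ℕ} (w g : Fin p → ℝ) (hw : Antitone w) (hg : Antitone g)
    (κ₀ : Equiv.Perm (Fin p)) : ∑ j, w j * g (κ₀ j) ≤ ∑ j, w j * g j :=
  (hw.monovary hg).sum_mul_comp_perm_le_sum_mul

lemma rearr_sharp {p : ℕ} (w u : Fin p → ℝ) (hw : Antitone w)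
    (κ₀ : Equiv.Perm (Fin p)) : ∑ j, w j * |u (κ₀ j)| ≤ ∑ j, w j * sharp p u j := by
  have h := rearr w (sharp p u) hw (sharp_antitone p u)
    (κ₀.trans (Tuple.sort fun i => -|u i|).symm)
  simpa [sharp] using h

lemma sharp_sq_sum (p : ℕ) (u : Fin p → ℝ) : ∑ j, (sharp p u j) ^ 2 = ∑ j, (u j) ^ 2 := by
  simp only [sharp, sq_abs]
  exact Equiv.sum_comp (Tuple.sort fun i => -|u i|) (fun i => (u i) ^ 2)

lemma sorted_convex {p : ℕ} (w : Fin p → ℝ) (hw : Antitone w) (hw0 : ∀ j, 0 ≤ w j)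
    (b β : Fin p → ℝ) (t : ℝ) (ht0 : 0 ≤ t) (ht1 : t ≤ 1) :
    ∑ j, w j * sharp p (b - t • (b - β)) j ≤
      (1 - t) * ∑ j, w j * sharp p b j + t * ∑ j, w j * sharp p β j := by
  set v := b - t • (b - β) with hv
  set κ₀ := Tuple.sort fun i => -|v i| with hκ₀
  have h1 := rearr_sharp w b hw κ₀
  have h2 := rearr_sharp w β hw κ₀
  have h3 : ∑ j, w j * sharp p v j ≤
      (1 - t) * ∑ j, w j * |b (κ₀ j)| + t * ∑ j, w j * |β (κ₀ j)| := by
    rw [Finset.mul_sum, Finset.mul_sum, ← Finset.sum_add_distrib]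
    refine Finset.sum_le_sum fun j _ => ?_
    have : sharp p v j ≤ (1 - t) * |b (κ₀ j)| + t * |β (κ₀ j)| := by
      have e : v (κ₀ j) = (1 - t) * b (κ₀ j) + t * β (κ₀ j) := by
        simp [hv]; ring
      change |v (κ₀ j)| ≤ _
      rw [e]
      refine (abs_add_le _ _).trans ?_
      rw [abs_mul, abs_mul, abs_of_nonneg ht0, abs_of_nonneg (by linarith : 0 ≤ 1 - t)]
    calc _ ≤ w j * ((1 - t) * |b (κ₀ j)| + t * |β (κ₀ j)|) :=
          mul_le_mul_of_nonneg_left this (hw0 j)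
      _ = _ := by ring
  have h4 := mul_le_mul_of_nonneg_left h1 (by linarith : 0 ≤ 1 - t)
  have h5 := mul_le_mul_of_nonneg_left h2 ht0
  linarith

lemma sorted_compat {p : ℕ} (w : Fin p → ℝ) (hw : Antitone w) (hw0 : ∀ j, 0 ≤ w j)
    (b β : Fin p → ℝ) (s : ℕ) (hs : sparsity p β ≤ s) :
    ∑ j, w j * sharp p β j - ∑ j, w j * sharp p b j ≤
      ∑ j : Fin p, (if (j : ℕ) < s then w j else 0) * sharp p (b - β) j
      - ∑ j : Fin p, (if (j : ℕ) < s then 0 else w j) * sharp p (b - β) j := by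
  set u := b - β with hu
  set M : ℝ := ∑ i, |u i| + 1 with hM
  have huM : ∀ i, |u i| < M := fun i => by
    have : |u i| ≤ ∑ i, |u i| :=
      Finset.single_le_sum (f := fun i => |u i|) (fun i _ => abs_nonneg _) (Finset.mem_univ i)
    linarith
  set v : Fin p → ℝ := fun i => if β i ≠ 0 then M + |β i| else |u i| with hv
  set ρ := Tuple.sort fun i => -v i with hρ
  have hmono : ∀ j k, j ≤ k → v (ρ k) ≤ v (ρ j) := fun j k h => by
    have := Tuple.monotone_sort (fun i => -v i) h
    simp only [Function.comp] at this
    linarith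
  -- support comes first
  have hT : ∀ j k, j ≤ k → β (ρ k) ≠ 0 → β (ρ j) ≠ 0 := by
    intro j k hjk hk hj
    have h := hmono j k hjk
    simp only [hv, hk, hj, ne_eq, not_true_eq_false, not_false_eq_true, if_true, if_false] at h
    have := huM (ρ j)
    have := abs_nonneg (β (ρ k))
    linarith
  have hoff : ∀ j : Fin p, s ≤ (j : ℕ) → β (ρ j) = 0 := by
    intro j hj
    by_contra hne
    have hsub : (Finset.Iic j).map ρ.toEmbedding ⊆ Finset.univ.filter fun i => β i ≠ 0 := by
      intro i hi
      simp only [Finset.mem_map, Finset.mem_Iic] at hi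
      obtain ⟨k, hk, rfl⟩ := hi
      simpa using hT k j hk hne
    have hc := Finset.card_le_card hsub
    rw [Finset.card_map, Fin.card_Iic] at hc
    unfold sparsity at hs
    omega
  have hβanti : Antitone fun j => |β (ρ j)| := by
    intro j k hjk
    by_cases hk : β (ρ k) = 0
    · simp [hk]
    · have hj := hT j k hjk hk
      have h := hmono j k hjk
      simp only [hv, hk, hj, ne_eq, not_false_eq_true, if_true] at h
      simpa using h
  have huanti : ∀ j k : Fin p, s ≤ (j : ℕ) → j ≤ k → |u (ρ k)| ≤ |u (ρ j)| := by
    intro j k hj hjk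
    have h := hmono j k hjk
    have h1 := hoff j hj
    have h2 := hoff k (hj.trans hjk)
    simpa only [hv, h1, h2, ne_eq, not_true_eq_false, if_false] using h
  have hsharp : ∀ j : Fin p, s ≤ (j : ℕ) → sharp p u j ≤ |u (ρ j)| := by
    intro j hj
    set κ := Tuple.sort fun i => -|u i| with hκ
    have : ∃ m, m ≤ j ∧ ∃ k, j ≤ k ∧ κ m = ρ k := by
      by_contra hcon
      push Not at hcon
      have hsub : (Finset.Iic j).map κ.toEmbedding ⊆ (Finset.Iio j).map ρ.toEmbedding := by
        intro i hi
        simp only [Finset.mem_map, Finset.mem_Iic] at hi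
        obtain ⟨m, hm, rfl⟩ := hi
        simp only [Finset.mem_map, Finset.mem_Iio]
        refine ⟨ρ.symm (κ m), ?_, by simp⟩
        by_contra hlt
        exact hcon m hm _ (not_lt.mp hlt) (by simp)
      have hc := Finset.card_le_card hsub
      rw [Finset.card_map, Finset.card_map, Fin.card_Iic, Fin.card_Iio] at hc
      omega
    obtain ⟨m, hm, k, hk, he⟩ := this
    calc sharp p u j ≤ sharp p u m := sharp_antitone p u hm
      _ = |u (ρ k)| := by rw [← he]; rfl
      _ ≤ _ := huanti j k hj hk
  have e1 : ∑ j, w j * sharp p β j ≤ ∑ j, w j * |β (ρ j)| := by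
    have h := rearr w (fun j => |β (ρ j)|) hw hβanti
      ((Tuple.sort fun i => -|β i|).trans ρ.symm)
    simpa [sharp] using h
  have e2 := rearr_sharp w b hw ρ
  have hw' : Antitone fun j : Fin p => if (j : ℕ) < s then w j else 0 := by
    intro j k hjk
    have hjk' : (j : ℕ) ≤ k := hjk
    by_cases hk : (k : ℕ) < s
    · simp only [hk, lt_of_le_of_lt hjk' hk, if_true]; exact hw hjk
    · simp only [hk, if_false]; split_ifs <;> simp [hw0]
  have e3 := rearr_sharp _ u hw' ρ
  have e4 : ∑ j : Fin p, (if (j : ℕ) < s then 0 else w j) * sharp p u j ≤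
      ∑ j : Fin p, (if (j : ℕ) < s then 0 else w j) * |u (ρ j)| := by
    refine Finset.sum_le_sum fun j _ => ?_
    by_cases hj : (j : ℕ) < s
    · simp [hj]
    · simp only [hj, if_false]
      exact mul_le_mul_of_nonneg_left (hsharp j (not_lt.mp hj)) (hw0 j)
  have e5 : ∑ j, w j * |β (ρ j)| + ∑ j : Fin p, (if (j : ℕ) < s then 0 else w j) * |u (ρ j)| ≤
      ∑ j, w j * |b (ρ j)| + ∑ j : Fin p, (if (j : ℕ) < s then w j else 0) * |u (ρ j)| := by
    rw [← Finset.sum_add_distrib, ← Finset.sum_add_distrib]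
    refine Finset.sum_le_sum fun j _ => ?_
    by_cases hj : (j : ℕ) < s
    · simp only [hj, if_true, zero_mul, add_zero]
      rw [← mul_add]
      refine mul_le_mul_of_nonneg_left ?_ (hw0 j)
      have := abs_sub (b (ρ j)) (u (ρ j))
      simpa [hu] using this
    · have h0 := hoff j (not_lt.mp hj)
      simp [hj, hu, h0]
  linarith

lemma sum_Icc_fin {p s : ℕ} (hsp : s ≤ p) (g : ℕ → ℝ) :
    ∑ j ∈ Finset.Icc 1 s, g j = ∑ j : Fin p, if (j : ℕ) < s then g (j + 1) else 0 := by
  rw [Fin.sum_univ_eq_sum_range (fun j => if j < s then g (j + 1) else 0) p,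
    ← Finset.sum_filter]
  have : (Finset.range p).filter (fun j => j < s) = Finset.range s := by
    ext j; simp; omega
  rw [this, Finset.range_eq_Ico, Finset.sum_Ico_add' g 0 s 1]
  rfl

lemma cs_bound {p s : ℕ} (hsp : s ≤ p) (lam : ℕ → ℝ) (u : Fin p → ℝ) :
    ∑ j : Fin p, (if (j : ℕ) < s then lam (j + 1) else 0) * sharp p u j ≤
      Real.sqrt (∑ j ∈ Finset.Icc 1 s, lam j ^ 2) * l2 p u := by
  have h := Real.sum_mul_le_sqrt_mul_sqrt Finset.univ
    (fun j : Fin p => if (j : ℕ) < s then lam (j + 1) else 0) (sharp p u)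
  rw [sharp_sq_sum] at h
  rw [sum_Icc_fin hsp]
  simpa [l2, ite_pow] using h

lemma slopeWeight_nonneg {n p : ℕ} {A σ : ℝ} (hA : 0 ≤ A) (hσ : 0 ≤ σ) (j : ℕ) :
    0 ≤ slopeWeight n p A σ j := by
  unfold slopeWeight; positivity

lemma slopeWeight_anti {n p : ℕ} {A σ : ℝ} (hp : 0 < p) (hA : 0 ≤ A) (hσ : 0 ≤ σ) :
    Antitone fun j : Fin p => slopeWeight n p A σ ((j : ℕ) + 1) := by
  intro j k hjk
  have hjk' : (j : ℕ) ≤ k := hjk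
  have hp' : (0 : ℝ) < p := by exact_mod_cast hp
  simp only [slopeWeight]
  gcongr

lemma normn_sq {n : ℕ} (u : Fin n → ℝ) : normn n u ^ 2 = (∑ i, (u i) ^ 2) / n :=
  Real.sq_sqrt (by positivity)

lemma basic_ineq {n p : ℕ} {A σ : ℝ} (hp : 0 < p) (hA : 0 ≤ A) (hσ : 0 ≤ σ)
    (X : Matrix (Fin n) (Fin p) ℝ) (ξ f : Fin n → ℝ) (b β : Fin p → ℝ)
    (hb : IsSlopeSol n p X (slopeWeight n p A σ) (f + ξ) b) :
    normn n (X.mulVec b - f) ^ 2 + normn n (X.mulVec (b - β)) ^ 2 ≤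
      normn n (X.mulVec β - f) ^ 2 + 2 * ((1 / n : ℝ) * ∑ i, ξ i * X.mulVec (b - β) i)
      + 2 * (sortedL1 p (slopeWeight n p A σ) β - sortedL1 p (slopeWeight n p A σ) b) := by
  set lam := slopeWeight n p A σ
  set u := b - β with hu
  set I : ℝ := (∑ i, (X.mulVec b i - (f + ξ) i) * X.mulVec u i) / n with hI
  have key : ∀ t : ℝ, 0 < t → t ≤ 1 →
      2 * I - 2 * (sortedL1 p lam β - sortedL1 p lam b) ≤ normn n (X.mulVec u) ^ 2 * t := by
    intro t ht ht1
    have h1 := hb (b - t • u)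
    have h2 : sortedL1 p lam (b - t • u) ≤ (1 - t) * sortedL1 p lam b + t * sortedL1 p lam β :=
      sorted_convex _ (slopeWeight_anti hp hA hσ) (fun j => slopeWeight_nonneg hA hσ _)
        b β t ht.le ht1
    have h3 : normn n (X.mulVec (b - t • u) - (f + ξ)) ^ 2 =
        normn n (X.mulVec b - (f + ξ)) ^ 2 - 2 * t * I + t ^ 2 * normn n (X.mulVec u) ^ 2 := by
      rw [normn_sq, normn_sq, normn_sq, hI, mul_div_assoc', mul_div_assoc', ← sub_div, ← add_div,
        Finset.mul_sum, Finset.mul_sum, ← Finset.sum_sub_distrib, ← Finset.sum_add_distrib]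
      congr 1
      refine Finset.sum_congr rfl fun i _ => ?_
      simp only [Matrix.mulVec_sub, Matrix.mulVec_smul, Pi.sub_apply, Pi.smul_apply, smul_eq_mul]
      ring
    rw [h3] at h1
    have h4 : t * (2 * I - 2 * (sortedL1 p lam β - sortedL1 p lam b)) ≤
        t * (normn n (X.mulVec u) ^ 2 * t) := by nlinarith
    exact le_of_mul_le_mul_left h4 ht
  have lim : 2 * I - 2 * (sortedL1 p lam β - sortedL1 p lam b) ≤ 0 := by
    by_contra hcon
    push Not at hcon
    set d := 2 * I - 2 * (sortedL1 p lam β - sortedL1 p lam b)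
    set N2 := normn n (X.mulVec u) ^ 2
    have hN : 0 ≤ N2 := sq_nonneg _
    have h1 := key 1 one_pos le_rfl
    have h2 := key (d / (2 * (N2 + 1))) (by positivity) (by
      rw [div_le_one (by positivity)]; linarith)
    have h3 : N2 * (d / (2 * (N2 + 1))) ≤ d / 2 := by
      rw [mul_div_assoc', div_le_div_iff₀ (by positivity) (by norm_num)]
      nlinarith
    linarith
  have pol : normn n (X.mulVec b - f) ^ 2 + normn n (X.mulVec u) ^ 2
      - normn n (X.mulVec β - f) ^ 2 - 2 * ((1 / n : ℝ) * ∑ i, ξ i * X.mulVec u i) = 2 * I := by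
    rw [normn_sq, normn_sq, normn_sq, hI, mul_div_assoc', mul_comm (1 / (n : ℝ)),
      mul_one_div, mul_div_assoc', ← add_div, ← sub_div, ← sub_div,
      Finset.mul_sum, Finset.mul_sum, ← Finset.sum_add_distrib, ← Finset.sum_sub_distrib,
      ← Finset.sum_sub_distrib]
    congr 1
    refine Finset.sum_congr rfl fun i _ => ?_
    simp only [hu, Matrix.mulVec_sub, Pi.sub_apply, Pi.add_apply]
    ring
  linarith

lemma theta_cone {n p : ℕ} (X : Matrix (Fin n) (Fin p) ℝ) (lam : ℕ → ℝ) (s : ℕ) (c : ℝ)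
    (u : Fin p → ℝ)
    (h : sortedL1 p lam u ≤ (1 + c) * l2 p u * Real.sqrt (∑ j ∈ Finset.Icc 1 s, lam j ^ 2)) :
    thetaWRE n p X lam s c * l2 p u ≤ normn n (X.mulVec u) := by
  have hN : 0 ≤ normn n (X.mulVec u) := Real.sqrt_nonneg _
  by_cases hu : u = 0
  · have : l2 p u = 0 := by simp [hu, l2]
    rw [this, mul_zero]; exact hN
  · have hpos : 0 < l2 p u := by
      obtain ⟨j, hj⟩ := Function.ne_iff.mp hu
      refine Real.sqrt_pos.mpr (Finset.sum_pos' (fun i _ => sq_nonneg _) ⟨j, Finset.mem_univ _, ?_⟩)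
      have : u j ≠ 0 := hj
      positivity
    rw [← le_div_iff₀ hpos]
    refine csInf_le ⟨0, ?_⟩ ⟨u, ⟨hu, h⟩, rfl⟩
    rintro _ ⟨δ, _, rfl⟩
    exact div_nonneg (Real.sqrt_nonneg _) (Real.sqrt_nonneg _)

lemma theta_anti {n p : ℕ} (hp : 0 < p) (X : Matrix (Fin n) (Fin p) ℝ) (lam : ℕ → ℝ)
    (hlam : ∀ j, 0 ≤ lam j) (hanti : Antitone fun j : Fin p => lam ((j : ℕ) + 1)) 
    (s : ℕ) (hs : 1 ≤ s) (hsp : s ≤ p) (c c' : ℝ) (hc : 0 ≤ c) (hcc : c ≤ c') :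
    thetaWRE n p X lam s c' ≤ thetaWRE n p X lam s c := by
  refine csInf_le_csInf ⟨0, ?_⟩ ?_ (Set.image_mono ?_)
  · rintro _ ⟨δ, _, rfl⟩
    exact div_nonneg (Real.sqrt_nonneg _) (Real.sqrt_nonneg _)
  · refine Set.Nonempty.image _ ⟨Pi.single ⟨0, hp⟩ 1, by simp, ?_⟩
    set e : Fin p → ℝ := Pi.single ⟨0, hp⟩ 1 with he
    have hsp0 : sparsity p e ≤ s := by
      have : (Finset.univ.filter fun j => e j ≠ 0) ⊆ {⟨0, hp⟩} := by
        intro j hj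
        by_contra hne
        simp only [Finset.mem_singleton] at hne
        simp [he, Pi.single_eq_of_ne hne] at hj
      have := Finset.card_le_card this
      simp only [Finset.card_singleton] at this
      exact this.trans hs
    -- compare with the zero-deviation compatibility bound
    have h := sorted_compat _ hanti (fun j => hlam _) 0 e s hsp0
    have hneg : ∀ w : Fin p → ℝ, ∑ j, w j * sharp p (0 - e) j = ∑ j, w j * sharp p e j := by
      intro w; simp [sharp]
    rw [hneg, hneg] at h
    have h0 : ∑ j : Fin p, lam ((j : ℕ) + 1) * sharp p 0 j = 0 := by simp [sharp]
    have hQ : 0 ≤ ∑ j : Fin p, (if (j : ℕ) < s then 0 else lam ((j : ℕ) + 1)) * sharp p e j := by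
      refine Finset.sum_nonneg fun j _ => mul_nonneg ?_ (abs_nonneg _)
      split_ifs
      · exact le_rfl
      · exact hlam _
    have hcs := cs_bound hsp lam e
    have hR := Real.sqrt_nonneg (∑ j ∈ Finset.Icc 1 s, lam j ^ 2)
    have hD : 0 ≤ l2 p e := Real.sqrt_nonneg _
    have := mul_nonneg hc (mul_nonneg hR hD)
    unfold sortedL1
    nlinarith
  · rintro δ ⟨h1, h2⟩
    refine ⟨h1, h2.trans ?_⟩
    have : 0 ≤ l2 p δ := Real.sqrt_nonneg _
    gcongr

/-- Data extracted from the event and the estimator. -/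
lemma slope_data {n p : ℕ} (hn : 0 < n) (hp : 0 < p)
    (X : Matrix (Fin n) (Fin p) ℝ) (σ : ℝ) (hσ : 0 < σ) (γ : ℝ) (hγ0 : 0 < γ)
    (A : ℝ) (hA : (4 + Real.sqrt 2) / γ ≤ A)
    (δ₀ : ℝ) (hδ₀0 : 0 < δ₀) (hδ₀1 : δ₀ < 1)
    (ξ : Fin n → ℝ) (hevent : MainEvent n p σ δ₀ X ξ) 
    (s : ℕ) (hs : 1 ≤ s) (hsp : s ≤ p) (f : Fin n → ℝ) (b : Fin p → ℝ)
    (hb : IsSlopeSol n p X (slopeWeight n p A σ) (f + ξ) b)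
    (β : Fin p → ℝ) (hβ : sparsity p β ≤ s) :
    ∃ P Q K a : ℝ, 0 ≤ P ∧ 0 ≤ Q ∧ 0 ≤ K ∧ 0 < a ∧ a ≤ γ ∧
      0 < ∑ j ∈ Finset.Icc 1 s, slopeWeight n p A σ j ^ 2 ∧
      sortedL1 p (slopeWeight n p A σ) (b - β) = P + Q ∧
      P ≤ Real.sqrt (∑ j ∈ Finset.Icc 1 s, slopeWeight n p A σ j ^ 2) * l2 p (b - β) ∧
      K ^ 2 ≤ Real.log (1 / δ₀) / (s * Real.log (2 * p / s)) *
        ∑ j ∈ Finset.Icc 1 s, slopeWeight n p A σ j ^ 2 ∧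
      normn n (X.mulVec b - f) ^ 2 + normn n (X.mulVec (b - β)) ^ 2 ≤
        normn n (X.mulVec β - f) ^ 2 +
          2 * max (a * (P + Q)) (a * K * normn n (X.mulVec (b - β))) + 2 * (P - Q) := by
  have hApos : 0 < A := lt_of_lt_of_le (by positivity) hA
  have hanti := slopeWeight_anti (n := n) hp hApos.le hσ.le
  have hnn := fun j => slopeWeight_nonneg (n := n) (p := p) hApos.le hσ.le j
  have hbasic := basic_ineq hp hApos.le hσ.le X ξ f b β hb
  have hcomp := sorted_compat _ hanti (fun j => hnn _) b β s hβ
  have hcs := cs_bound hsp (slopeWeight n p A σ) (b - β)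
  have hn' : (0 : ℝ) < n := by exact_mod_cast hn
  have hs' : (0 : ℝ) < s := by exact_mod_cast hs
  have hp' : (0 : ℝ) < p := by exact_mod_cast hp
  have hsp' : (s : ℝ) ≤ p := by exact_mod_cast hsp
  have hlogs : 0 < Real.log (2 * p / s) := by
    apply Real.log_pos
    rw [lt_div_iff₀ hs']; linarith
  have hL : 0 < Real.log (1 / δ₀) := Real.log_pos (by rw [lt_div_iff₀ hδ₀0]; linarith)
  have hΛ : A ^ 2 * σ ^ 2 / n * (s * Real.log (2 * p / s)) ≤
      ∑ j ∈ Finset.Icc 1 s, slopeWeight n p A σ j ^ 2 := by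
    have : ∀ j ∈ Finset.Icc 1 s, A ^ 2 * σ ^ 2 / n * Real.log (2 * p / s) ≤
        slopeWeight n p A σ j ^ 2 := by
      intro j hj
      rw [Finset.mem_Icc] at hj
      have hj0 : (0 : ℝ) < j := by exact_mod_cast hj.1
      have hjs : (j : ℝ) ≤ s := by exact_mod_cast hj.2
      have hle : Real.log (2 * p / s) ≤ Real.log (2 * p / j) := by gcongr
      have h0 : 0 ≤ Real.log (2 * p / j) / n := div_nonneg (hlogs.le.trans hle) hn'.le
      rw [slopeWeight, mul_pow, Real.sq_sqrt h0, mul_pow]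
      calc _ ≤ A ^ 2 * σ ^ 2 / n * Real.log (2 * p / j) := by gcongr
        _ = _ := by ring
    have := Finset.card_nsmul_le_sum _ _ _ this
    simp only [Nat.card_Icc, add_tsub_cancel_right, nsmul_eq_mul] at this
    linarith
  set lam := slopeWeight n p A σ with hlam
  refine ⟨_, ∑ j : Fin p, (if (j : ℕ) < s then 0 else lam ((j : ℕ) + 1)) * sharp p (b - β) j,
    A * σ * Real.sqrt (Real.log (1 / δ₀) / n), (4 + Real.sqrt 2) / A, ?_, ?_,
    by positivity, by positivity, ?_, lt_of_lt_of_le (by positivity) hΛ, ?_, hcs, ?_, ?_⟩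
  · refine Finset.sum_nonneg fun j _ => mul_nonneg ?_ (abs_nonneg _)
    split_ifs
    · exact hnn _
    · exact le_rfl
  · refine Finset.sum_nonneg fun j _ => mul_nonneg ?_ (abs_nonneg _)
    split_ifs
    · exact le_rfl
    · exact hnn _
  · rw [div_le_iff₀ hγ0] at hA
    rw [div_le_iff₀ hApos]; linarith
  · rw [sortedL1, ← Finset.sum_add_distrib]
    refine Finset.sum_congr rfl fun j _ => ?_
    split_ifs <;> ring
  · rw [mul_pow, Real.sq_sqrt (by positivity), mul_pow]
    calc _ = Real.log (1 / δ₀) / (s * Real.log (2 * p / s)) *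
          (A ^ 2 * σ ^ 2 / n * (s * Real.log (2 * p / s))) := by field_simp
      _ ≤ _ := by gcongr
  · have hE := hevent (b - β)
    have hH : Hfun n p σ (b - β) = (4 + Real.sqrt 2) / A * sortedL1 p lam (b - β) := by
      rw [Hfun, sortedL1, div_mul_eq_mul_div, mul_div_assoc, Finset.sum_div]
      congr 1
      refine Finset.sum_congr rfl fun j _ => ?_
      rw [hlam, slopeWeight]
      push_cast
      field_simp
    have hG : Gfun n p σ δ₀ X (b - β) = (4 + Real.sqrt 2) / A *
        (A * σ * Real.sqrt (Real.log (1 / δ₀) / n)) * normn n (X.mulVec (b - β)) := by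
      rw [Gfun]; field_simp
    have hS : sortedL1 p lam (b - β) =
        ∑ j : Fin p, (if (j : ℕ) < s then lam ((j : ℕ) + 1) else 0) * sharp p (b - β) j +
        ∑ j : Fin p, (if (j : ℕ) < s then 0 else lam ((j : ℕ) + 1)) * sharp p (b - β) j := by
      rw [sortedL1, ← Finset.sum_add_distrib]
      refine Finset.sum_congr rfl fun j _ => ?_
      split_ifs <;> ring
    rw [hH, hG, hS] at hE
    have : sortedL1 p lam β - sortedL1 p lam b ≤ _ := hcomp
    linarith

/-- Scalar part of the oracle inequality. -/
lemma scalar_oracle (P Q K a γ τ N D R θ m F B : ℝ) (hP : 0 ≤ P) (hQ : 0 ≤ Q) (hK : 0 ≤ K)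
    (ha : 0 < a) (haγ : a ≤ γ) (hτ : 0 ≤ τ) (hτ1 : τ < 1 - γ) (hN : 0 ≤ N)
    (hR : 0 < R) (hθ : 0 < θ) (hPR : P ≤ R * D) (hKm : K ^ 2 ≤ m * R ^ 2)
    (hcone : P + Q ≤ (1 + (1 + γ + τ) / (1 - γ - τ)) * D * R → θ * D ≤ N)
    (hb : F + N ^ 2 ≤ B + 2 * max (a * (P + Q)) (a * K * N) + 2 * (P - Q)) :
    2 * τ * (P + Q) + F ≤ B + (1 + γ + τ) ^ 2 * max m (1 / θ ^ 2) * R ^ 2 := by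
  have hd : 0 < 1 - γ - τ := by linarith
  set g := 1 + γ + τ with hg
  have hg0 : 0 < g := by linarith
  have hM1 : g ^ 2 * m * R ^ 2 ≤ g ^ 2 * max m (1 / θ ^ 2) * R ^ 2 := by
    gcongr; exact le_max_left _ _
  have hM2 : g ^ 2 * (1 / θ ^ 2) * R ^ 2 ≤ g ^ 2 * max m (1 / θ ^ 2) * R ^ 2 := by
    gcongr; exact le_max_right _ _
  have hpos : 0 ≤ g ^ 2 * (1 / θ ^ 2) * R ^ 2 := by positivity
  rcases le_total (a * K * N) (a * (P + Q)) with h | h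
  · rw [max_eq_left h] at hb
    have haS : a * (P + Q) ≤ γ * (P + Q) := by gcongr
    by_cases hneg : g * P < (1 - γ - τ) * Q
    · have := sq_nonneg N
      have e : τ * (P + Q) + γ * (P + Q) + (P - Q) = g * P - (1 - γ - τ) * Q := by
        rw [hg]; ring
      nlinarith
    · push Not at hneg
      have hQ' : Q ≤ g / (1 - γ - τ) * P := by
        rw [div_mul_eq_mul_div, le_div_iff₀ hd]; linarith
      have hc : P + Q ≤ (1 + g / (1 - γ - τ)) * D * R := by
        calc P + Q ≤ (1 + g / (1 - γ - τ)) * P := by linarith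
          _ ≤ (1 + g / (1 - γ - τ)) * (R * D) := by gcongr
          _ = _ := by ring
      have hD := hcone hc
      have hD' : D ≤ N / θ := by rw [le_div_iff₀ hθ]; linarith
      have h1 : P ≤ R * (N / θ) := hPR.trans (by gcongr)
      have h2 : g * P ≤ g * (R * (N / θ)) := by gcongr
      have h3 : 2 * (g * (R * (N / θ))) ≤ N ^ 2 + g ^ 2 * (1 / θ ^ 2) * R ^ 2 := by
        have := sq_nonneg (N - g * R / θ)
        have e : (N - g * R / θ) ^ 2 =
          N ^ 2 + g ^ 2 * (1 / θ ^ 2) * R ^ 2 - 2 * (g * (R * (N / θ))) := by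
          field_simp; ring
        linarith
      have e : τ * (P + Q) + γ * (P + Q) + (P - Q) = g * P - (1 - γ - τ) * Q := by
        rw [hg]; ring
      have := mul_nonneg hd.le hQ
      nlinarith
  · rw [max_eq_right h] at hb
    have hS : P + Q ≤ K * N := by
      rw [mul_assoc] at h
      exact le_of_mul_le_mul_left h ha
    have hKN : 0 ≤ K * N := mul_nonneg hK hN
    have h1 : a * (K * N) ≤ γ * (K * N) := by gcongr
    have h2 : (1 + τ) * (P + Q) ≤ (1 + τ) * (K * N) := by gcongr
    have h3 : 2 * (g * (K * N)) ≤ N ^ 2 + g ^ 2 * K ^ 2 := by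
      nlinarith [sq_nonneg (N - g * K)]
    have h4 : g ^ 2 * K ^ 2 ≤ g ^ 2 * (m * R ^ 2) := by gcongr
    have e : γ * (K * N) + (1 + τ) * (K * N) = g * (K * N) := by rw [hg]; ring
    nlinarith

/-- Scalar part of the `ℓ₂` estimation bound. -/
lemma scalar_l2 (P Q K a γ N D R θ m : ℝ) (hP : 0 ≤ P) (hQ : 0 ≤ Q) (hK : 0 ≤ K)
    (ha : 0 < a) (haγ : a ≤ γ) (hγ1 : γ < 1) (hN : 0 ≤ N) (hm : 0 ≤ m) (hD : 0 ≤ D)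
    (hR : 0 < R) (hθ : 0 < θ) (hPR : P ≤ R * D) (hKm : K ^ 2 ≤ m * R ^ 2)
    (hcone : P + Q ≤ (1 + (1 + γ) / (1 - γ)) * D * R → θ * D ≤ N)
    (hb : 2 * N ^ 2 ≤ 2 * max (a * (P + Q)) (a * K * N) + 2 * (P - Q)) :
    D ≤ (1 + γ) * max m (1 / θ ^ 2) * R := by
  have hd : 0 < 1 - γ := by linarith
  have hg0 : 0 < 1 + γ := by linarith
  set c := (1 + γ) / (1 - γ) with hc
  have hc0 : 0 ≤ c := by positivity
  have hMm : m ≤ max m (1 / θ ^ 2) := le_max_left _ _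
  have hMθ : 1 / θ ^ 2 ≤ max m (1 / θ ^ 2) := le_max_right _ _
  set M := max m (1 / θ ^ 2)
  rcases le_total (a * K * N) (a * (P + Q)) with h | h
  · rw [max_eq_left h] at hb
    have haS : a * (P + Q) ≤ γ * (P + Q) := by gcongr
    have hneg : (1 - γ) * Q ≤ (1 + γ) * P := by nlinarith [sq_nonneg N]
    have hQ' : Q ≤ c * P := by
      rw [hc, div_mul_eq_mul_div, le_div_iff₀ hd]; linarith
    have hD' := hcone (by
      calc P + Q ≤ (1 + c) * P := by linarith
        _ ≤ (1 + c) * (R * D) := by gcongr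
        _ = _ := by ring)
    have hQn := mul_nonneg hd.le hQ
    have h1 : N ^ 2 ≤ (1 + γ) * (R * D) := by nlinarith
    have h2 : (θ * D) ^ 2 ≤ N ^ 2 := by gcongr
    have h3 : D * θ ^ 2 ≤ (1 + γ) * R := by
      rcases hD.eq_or_lt with h0 | h0
      · rw [← h0, zero_mul]; positivity
      · refine le_of_mul_le_mul_right ?_ h0
        nlinarith
    calc D ≤ (1 + γ) * R / θ ^ 2 := by rw [le_div_iff₀ (by positivity)]; exact h3
      _ = (1 + γ) * (1 / θ ^ 2) * R := by ring
      _ ≤ _ := by gcongr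
  · rw [max_eq_right h] at hb
    have hS : P + Q ≤ K * N := by
      rw [mul_assoc] at h
      exact le_of_mul_le_mul_left h ha
    have hKN : 0 ≤ K * N := mul_nonneg hK hN
    have h1 : a * (K * N) ≤ γ * (K * N) := by gcongr
    have h2 : N ^ 2 ≤ (1 + γ) * K * N := by nlinarith
    have h3 : N ≤ (1 + γ) * K := by
      rcases hN.eq_or_lt with h0 | h0
      · rw [← h0]; positivity
      · refine le_of_mul_le_mul_right ?_ h0
        nlinarith
    by_cases hcn : P + Q ≤ (1 + c) * D * R
    · have hDN := hcone hcn
      have hM0 : 0 ≤ M := hm.trans hMm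
      -- `θ D ≤ (1+γ) K`, `K² ≤ M R²`, `1 ≤ M θ²`
      have h4 : 1 ≤ M * θ ^ 2 := by
        rwa [div_le_iff₀ (by positivity)] at hMθ
      have h5 : K ^ 2 ≤ (M * θ * R) ^ 2 := by
        calc K ^ 2 ≤ m * R ^ 2 := hKm
          _ ≤ M * R ^ 2 * 1 := by rw [mul_one]; gcongr
          _ ≤ M * R ^ 2 * (M * θ ^ 2) := by gcongr
          _ = _ := by ring
      have h6 : K ≤ M * θ * R := le_of_sq_le_sq h5 (by positivity)
      refine le_of_mul_le_mul_left ?_ hθ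
      calc θ * D ≤ (1 + γ) * K := hDN.trans h3
        _ ≤ (1 + γ) * (M * θ * R) := by gcongr
        _ = _ := by ring
    · push Not at hcn
      have h4 : D * R ≤ (1 + c) * D * R := by
        have := mul_nonneg hc0 (mul_nonneg hD hR.le)
        nlinarith
      have h5 : K * N ≤ K * ((1 + γ) * K) := by gcongr
      have h6 : (1 + γ) * K ^ 2 ≤ (1 + γ) * (M * R ^ 2) := by
        have : m * R ^ 2 ≤ M * R ^ 2 := by gcongr
        have := hKm.trans this
        gcongr
      refine le_of_mul_le_mul_right ?_ hR
      nlinarith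

/-- Theorem 7 (deterministic oracle inequality for the Slope estimator on the main
event); the constant `C'_{γ,τ}(s,δ₀)` is finite exactly when `WRE(s,c₀)` holds, so
the inequality is asserted for those `s` for which `WRE(s,c₀)` holds. -/
theorem slope_oracle_on_event
    {n p : ℕ} (hn : 0 < n) (hp : 0 < p)
    (X : Matrix (Fin n) (Fin p) ℝ) (σ : ℝ) (hσ : 0 < σ)
    (γ : ℝ) (hγ0 : 0 < γ) (hγ1 : γ < 1)
    (τ : ℝ) (hτ0 : 0 ≤ τ) (hτ1 : τ < 1 - γ)
    (A : ℝ) (hA : (4 + Real.sqrt 2) / γ ≤ A)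
    (hcol : ∀ j, normn n (X.mulVec (Pi.single j 1)) ≤ 1)
    (δ₀ : ℝ) (hδ₀0 : 0 < δ₀) (hδ₀1 : δ₀ < 1)
    (ξ : Fin n → ℝ) (hevent : MainEvent n p σ δ₀ X ξ) :
    -- oracle inequality, simultaneously over all f, all s with WRE(s,c₀), and all β
    -- with ‖β‖₀ = s
    (∀ s : ℕ, 1 ≤ s → s ≤ p →
      0 < thetaWRE n p X (slopeWeight n p A σ) s ((1 + γ + τ) / (1 - γ - τ)) →
      ∀ f : Fin n → ℝ, ∀ b : Fin p → ℝ,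
        IsSlopeSol n p X (slopeWeight n p A σ) (f + ξ) b →
        ∀ β : Fin p → ℝ, sparsity p β = s →
          2 * τ * sortedL1 p (slopeWeight n p A σ) (b - β) + normn n (X.mulVec b - f) ^ 2 ≤
            normn n (X.mulVec β - f) ^ 2 +
              Cslope n p X (slopeWeight n p A σ) γ τ s δ₀ *
                ∑ j ∈ Finset.Icc 1 s, slopeWeight n p A σ j ^ 2)
    ∧
    -- estimation bounds in the well-specified case
    (∀ s : ℕ, 1 ≤ s → s ≤ p →
      0 < thetaWRE n p X (slopeWeight n p A σ) s ((1 + γ + τ) / (1 - γ - τ)) →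
      ∀ βstar : Fin p → ℝ, sparsity p βstar ≤ s →
      ∀ b : Fin p → ℝ, IsSlopeSol n p X (slopeWeight n p A σ) (X.mulVec βstar + ξ) b →
        2 * τ * sortedL1 p (slopeWeight n p A σ) (b - βstar) ≤
          Cslope n p X (slopeWeight n p A σ) γ τ s δ₀ *
            ∑ j ∈ Finset.Icc 1 s, slopeWeight n p A σ j ^ 2
        ∧
        l2 p (b - βstar) ≤
          Cslope n p X (slopeWeight n p A σ) γ 0 s δ₀ / (1 + γ) *
            Real.sqrt (∑ j ∈ Finset.Icc 1 s, slopeWeight n p A σ j ^ 2)) := by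
  have hApos : 0 < A := lt_of_lt_of_le (by positivity) hA
  have main : ∀ s : ℕ, 1 ≤ s → s ≤ p →
      0 < thetaWRE n p X (slopeWeight n p A σ) s ((1 + γ + τ) / (1 - γ - τ)) →
      ∀ f : Fin n → ℝ, ∀ b : Fin p → ℝ,
        IsSlopeSol n p X (slopeWeight n p A σ) (f + ξ) b →
        ∀ β : Fin p → ℝ, sparsity p β ≤ s →
          2 * τ * sortedL1 p (slopeWeight n p A σ) (b - β) + normn n (X.mulVec b - f) ^ 2 ≤
            normn n (X.mulVec β - f) ^ 2 +
              Cslope n p X (slopeWeight n p A σ) γ τ s δ₀ *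
                ∑ j ∈ Finset.Icc 1 s, slopeWeight n p A σ j ^ 2 := by
    intro s hs hsp hθ f b hb β hβ
    obtain ⟨P, Q, K, a, hP, hQ, hK, ha, haγ, hΛ, hS, hPR, hKm, hbas⟩ :=
      slope_data hn hp X σ hσ γ hγ0 A hA δ₀ hδ₀0 hδ₀1 ξ hevent s hs hsp f b hb β hβ
    have hcone := theta_cone (n := n) X (slopeWeight n p A σ) s ((1 + γ + τ) / (1 - γ - τ)) (b - β)
    have hsq := Real.sq_sqrt hΛ.le
    rw [hS] at hcone
    rw [hS, Cslope]
    rw [← hsq] at hKm ⊢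
    exact scalar_oracle P Q K a γ τ _ _ _ _ _ _ _ hP hQ hK ha haγ hτ0 hτ1 (Real.sqrt_nonneg _)
      (Real.sqrt_pos.mpr hΛ) hθ hPR hKm hcone hbas
  refine ⟨fun s hs hsp hθ f b hb β hβ => main s hs hsp hθ f b hb β hβ.le, ?_⟩
  intro s hs hsp hθ β hβ b hb
  have hz : normn n (X.mulVec β - X.mulVec β) ^ 2 = 0 := by rw [normn_sq]; simp
  constructor
  · have h := main s hs hsp hθ (X.mulVec β) b hb β hβ
    rw [hz] at h
    have := sq_nonneg (normn n (X.mulVec b - X.mulVec β))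
    linarith
  · obtain ⟨P, Q, K, a, hP, hQ, hK, ha, haγ, hΛ, hS, hPR, hKm, hbas⟩ :=
      slope_data hn hp X σ hσ γ hγ0 A hA δ₀ hδ₀0 hδ₀1 ξ hevent s hs hsp _ b hb β hβ
    have hd : 0 < 1 - γ - τ := by linarith
    have hθ' : 0 < thetaWRE n p X (slopeWeight n p A σ) s ((1 + γ) / (1 - γ)) := by
      refine hθ.trans_le (theta_anti hp X _ (fun j => slopeWeight_nonneg hApos.le hσ.le j)
        (slopeWeight_anti hp hApos.le hσ.le) s hs hsp _ _ ?_ ?_)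
      · exact div_nonneg (by linarith) (by linarith)
      · apply div_le_div₀ <;> linarith
    have hcone := theta_cone (n := n) X (slopeWeight n p A σ) s ((1 + γ) / (1 - γ)) (b - β)
    rw [hS] at hcone
    have hsq := Real.sq_sqrt hΛ.le
    have hs' : (0 : ℝ) < s := by exact_mod_cast hs
    have hsp' : (s : ℝ) ≤ p := by exact_mod_cast hsp
    have hlogs : 0 < Real.log (2 * p / s) := by
      apply Real.log_pos
      rw [lt_div_iff₀ hs']; linarith
    have hL : 0 < Real.log (1 / δ₀) := Real.log_pos (by rw [lt_div_iff₀ hδ₀0]; linarith)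
    rw [hz, ← Matrix.mulVec_sub] at hbas
    rw [← hsq] at hKm
    have h := scalar_l2 P Q K a γ _ _ _ _ _ hP hQ hK ha haγ hγ1 (Real.sqrt_nonneg _)
      (by positivity : 0 ≤ Real.log (1 / δ₀) / (s * Real.log (2 * p / s))) (Real.sqrt_nonneg _)
      (Real.sqrt_pos.mpr hΛ) hθ' hPR hKm hcone (by unfold normn at hbas; linarith)
    refine h.trans (le_of_eq ?_)
    have hg : 1 + γ ≠ 0 := by linarith
    rw [Cslope]
    simp only [add_zero, sub_zero]
    field_simp
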